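/- Let x* ∈ ℝⁿ be a local optimal solution of the SISDP, suppose Slater's constraint qualification holds, and suppose the map (x,τ) ↦ ∇ₓg(x,τ) is continuous on ℝⁿ×T. Then there exist an integer q with 0 ≤ q ≤ n, points τ₁,…,τ_q ∈ T, nonnegative scalars λ₁,…,λ_q, and a matrix V ∈ S^m_+ such that: ∇f(x*) + Σ_{i=1}^q λᵢ ∇ₓg(x*,τᵢ) − (F₁•V, …, F_n•V)ᵀ = 0; F(x*)∘V = O and F(x*) ∈ S^m_+; Σ_{i=1}^q λᵢ g(x*,τᵢ) = 0; and g(x*,τ) ≤ 0 for all τ ∈ T. -/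

import Mathlib

open MeasureTheory Filter Topology

noncomputable def jordan {ι : Type*} [Fintype ι] (X Y : Matrix ι ι ℝ) : Matrix ι ι ℝ :=
  (2:ℝ)⁻¹ • (X * Y + Y * X)

lemma kkt_isCompact_convexHull {E : Type*} [NormedAddCommGroup E] [NormedSpace ℝ E]
    [FiniteDimensional ℝ E] {s : Set E} (hs : IsCompact s) : IsCompact (convexHull ℝ s) := by
  have key : convexHull ℝ s = ⋃ k ∈ Finset.range (Module.finrank ℝ E + 2),
      (fun p : (Fin k → ℝ) × (Fin k → E) => ∑ i, p.1 i • p.2 i) ''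
        ((stdSimplex ℝ (Fin k)) ×ˢ (Set.pi Set.univ fun _ => s)) := by
    apply Set.Subset.antisymm
    · intro x hx
      obtain ⟨ι, _, z, w, hz, hai, hw, hw1, hx'⟩ := eq_pos_convex_span_of_mem_convexHull hx
      have hcard := hai.card_le_finrank_succ
      have h2 : Module.finrank ℝ (vectorSpan ℝ (Set.range z)) ≤ Module.finrank ℝ E :=
        Submodule.finrank_le _
      let e := Fintype.equivFin ι
      simp only [Set.mem_iUnion]
      refine ⟨Fintype.card ι, Finset.mem_range.2 (by omega), (w ∘ e.symm, z ∘ e.symm), ⟨⟨?_, ?_⟩, ?_⟩, ?_⟩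
      · intro i; exact (hw _).le
      · rw [← hw1]; exact e.symm.sum_comp w
      · intro i _; exact hz ⟨_, rfl⟩
      · rw [← hx']; exact e.symm.sum_comp (fun i => w i • z i)
    · intro x hx
      simp only [Set.mem_iUnion] at hx
      obtain ⟨k, _, ⟨w, z⟩, ⟨⟨hw0, hw1⟩, hz⟩, rfl⟩ := hx
      exact (convex_convexHull ℝ s).sum_mem (fun i _ => hw0 i) hw1
        (fun i _ => subset_convexHull ℝ s (hz i trivial))
  rw [key]
  refine (Finset.range _).isCompact_biUnion fun k _ => ?_
  refine IsCompact.image ((isCompact_stdSimplex ℝ (Fin k)).prod (isCompact_univ_pi fun _ => hs)) ?_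
  fun_prop

lemma kkt_grad_ineq {E : Type*} [NormedAddCommGroup E] [InnerProductSpace ℝ E] [CompleteSpace E]
    {h : E → ℝ} (hc : ConvexOn ℝ Set.univ h) {x v : E} (hg : HasGradientAt h v x) (y : E) :
    h x + inner ℝ v (y - x) ≤ h y := by
  have hl : HasDerivAt (fun t : ℝ => x + t • (y - x)) (y - x) 0 := by
    simpa using ((hasDerivAt_id (0:ℝ)).smul_const (y - x)).const_add x
  have hd : HasDerivAt (fun t : ℝ => h (x + t • (y - x))) (inner ℝ v (y - x)) 0 := by
    have h1 : HasFDerivAt h (InnerProductSpace.toDual ℝ E v) (x + (0:ℝ) • (y - x)) := by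
      simpa using hg.hasFDerivAt
    exact (h1.comp_hasDerivAt (0:ℝ) hl).congr_deriv (by simp)
  have hcl : ConvexOn ℝ Set.univ (fun t : ℝ => h (x + t • (y - x))) := by
    have := hc.comp_affineMap (AffineMap.lineMap x y : ℝ →ᵃ[ℝ] E)
    have h2 : (h ∘ (AffineMap.lineMap x y : ℝ →ᵃ[ℝ] E)) = fun t : ℝ => h (x + t • (y - x)) := by
      funext t
      rw [Function.comp_apply, AffineMap.lineMap_apply, vsub_eq_sub, vadd_eq_add, add_comm]
    rw [h2] at this
    exact this
  have := hcl.le_slope_of_hasDerivAt (Set.mem_univ 0) (Set.mem_univ 1) one_pos hd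
  simp [slope_def_field] at this
  linarith

lemma kkt_feas {E I : Type*} [NormedAddCommGroup E] [InnerProductSpace ℝ E]
    [TopologicalSpace I] [CompactSpace I] (h : E → I → ℝ) (hg : E → I → E)
    (hc : Continuous fun p : E × I => h p.1 p.2) (hgc : Continuous fun p : E × I => hg p.1 p.2)
    (hineq : ∀ x y i, h x i + inner ℝ (hg x i) (y - x) ≤ h y i) (x d : E)
    (hx : ∀ i, h x i ≤ 0) (hd : ∀ i, h x i = 0 → inner ℝ (hg x i) d < 0) :
    ∀ᶠ t in 𝓝[>] (0:ℝ), ∀ i, h (x + t • d) i ≤ 0 := by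
  have key : ∀ᶠ t in 𝓝 (0:ℝ), ∀ i ∈ (Set.univ : Set I), 0 < t → h (x + t • d) i ≤ 0 := by
    apply isCompact_univ.eventually_forall_of_forall_eventually
    intro i _
    rcases (hx i).lt_or_eq with hlt | heq
    · have hct : Continuous fun p : ℝ × I => h (x + p.1 • d) p.2 :=
        hc.comp (by fun_prop : Continuous fun p : ℝ × I => (x + p.1 • d, p.2))
      have := hct.continuousAt (x := ((0:ℝ), i)) |>.tendsto.eventually_lt_const (u := 0) (by simpa using hlt)
      filter_upwards [this] with p hp _ using le_of_lt hp
    · have hct : Continuous fun p : ℝ × I => (inner ℝ (hg (x + p.1 • d) p.2) d : ℝ) :=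
        (hgc.comp (by fun_prop : Continuous fun p : ℝ × I => (x + p.1 • d, p.2))).inner
          continuous_const
      have := hct.continuousAt (x := ((0:ℝ), i)) |>.tendsto.eventually_lt_const (u := 0)
        (by simpa using hd i heq)
      filter_upwards [this] with p hp h0
      have h1 := hineq (x + p.1 • d) x p.2
      have h2 : x - (x + p.1 • d) = -(p.1 • d) := by abel
      rw [h2, inner_neg_right, inner_smul_right] at h1
      have := hx p.2
      have := mul_neg_of_pos_of_neg h0 hp
      linarith
  filter_upwards [nhdsWithin_le_nhds key, self_mem_nhdsWithin] with t ht h0 i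
  exact ht i trivial h0

lemma kkt_fritz {E I : Type*} [NormedAddCommGroup E] [InnerProductSpace ℝ E]
    [FiniteDimensional ℝ E]
    [TopologicalSpace I] [CompactSpace I] (h : E → I → ℝ) (hg : E → I → E)
    (hc : Continuous fun p : E × I => h p.1 p.2) (hgc : Continuous fun p : E × I => hg p.1 p.2)
    (hineq : ∀ x y i, h x i + inner ℝ (hg x i) (y - x) ≤ h y i) (x xb v : E)
    (f : E → ℝ) (hf : HasFDerivAt f (innerSL ℝ v) x)
    (hx : ∀ i, h x i ≤ 0) (hxb : ∀ i, h xb i < 0)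
    (hloc : ∀ᶠ y in 𝓝 x, (∀ i, h y i ≤ 0) → f x ≤ f y) :
    ∃ (q : ℕ) (idx : Fin q → I) (lam : Fin q → ℝ), q ≤ Module.finrank ℝ E ∧ (∀ i, 0 ≤ lam i) ∧
      (∀ i, h x (idx i) = 0) ∧ v + ∑ i, lam i • hg x (idx i) = 0 := by
  classical
  set S : Set E := hg x '' {i | h x i = 0} with hS
  have hScomp : IsCompact S := by
    have h1 : IsClosed {i | h x i = 0} := isClosed_eq (hc.comp (by fun_prop : Continuous fun i : I => (x, i))) continuous_const
    exact h1.isCompact.image (hgc.comp (by fun_prop : Continuous fun i : I => (x, i)))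
  have hneg : ∀ c ∈ S, inner ℝ c (xb - x) < 0 := by
    rintro _ ⟨i, hi, rfl⟩
    have := hineq x xb i
    have := hxb i
    have : h x i = 0 := hi
    linarith
  have h0 : (0:E) ∈ convexHull ℝ (insert v S) := by
    by_contra hn
    obtain ⟨L, u, hu, hL⟩ := geometric_hahn_banach_point_closed (convex_convexHull ℝ _)
      (kkt_isCompact_convexHull (hScomp.insert v)).isClosed hn
    have hL' : ∀ c ∈ insert v S, 0 < L c := fun c hc => by
      have := hL c (subset_convexHull ℝ _ hc)
      simp at hu
      linarith
    set d : E := -((InnerProductSpace.toDual ℝ E).symm L) with hd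
    have hLd : ∀ c, inner ℝ c d = - L c := fun c => by
      rw [hd, inner_neg_right, real_inner_comm, InnerProductSpace.toDual_symm_apply]
    have hfe := kkt_feas h hg hc hgc hineq x d hx (fun i hi => by
      rw [hLd]; linarith [hL' (hg x i) (Or.inr ⟨i, hi, rfl⟩)])
    have hl : HasDerivAt (fun t : ℝ => x + t • d) d 0 := by
      simpa using ((hasDerivAt_id (0:ℝ)).smul_const d).const_add x
    have hder : HasDerivAt (fun t : ℝ => f (x + t • d)) (inner ℝ v d) 0 := by
      have h1 : HasFDerivAt f (innerSL ℝ v) (x + (0:ℝ) • d) := by simpa using hf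
      exact (h1.comp_hasDerivAt (0:ℝ) hl).congr_deriv (by simp)
    have hvd : inner ℝ v d < 0 := by rw [hLd]; linarith [hL' v (Or.inl rfl)]
    have hsl := (hasDerivWithinAt_iff_tendsto_slope' (Set.self_notMem_Ioi)).1
      (hder.hasDerivWithinAt (s := Set.Ioi 0))
    have hsl2 := hsl.eventually (gt_mem_nhds hvd)
    have htend : Tendsto (fun t : ℝ => x + t • d) (𝓝[>] 0) (𝓝 x) := by
      have := hl.continuousAt.tendsto
      simp at this
      exact this.mono_left nhdsWithin_le_nhds
    obtain ⟨t, ht1, ht2, ht3, ht4⟩ := (hsl2.and (hfe.and ((htend.eventually hloc).and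
      self_mem_nhdsWithin))).exists
    have h5 := ht3 ht2
    have ht4' : 0 < t := ht4
    simp only [slope_def_field, zero_smul, add_zero, sub_zero] at ht1
    have := div_nonneg (sub_nonneg.2 h5) ht4'.le
    linarith
  obtain ⟨ι, _, z, w, hz, hai, hw, hw1, hsum⟩ := eq_pos_convex_span_of_mem_convexHull h0
  have hcard := hai.card_le_finrank_succ
  have h2 : Module.finrank ℝ (vectorSpan ℝ (Set.range z)) ≤ Module.finrank ℝ E :=
    Submodule.finrank_le _
  obtain ⟨i0, hi0⟩ : ∃ i0, z i0 ∉ S := by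
    by_contra hcon
    push Not at hcon
    have h3 : inner ℝ (∑ i, w i • z i) (xb - x) = ∑ i, w i * inner ℝ (z i) (xb - x) := by
      simp [sum_inner, inner_smul_left]
    rw [hsum, inner_zero_left] at h3
    have hne : (Finset.univ : Finset ι).Nonempty := by
      rw [Finset.nonempty_iff_ne_empty]; intro he; rw [he] at hw1; simp at hw1
    have := Finset.sum_neg (fun i (_ : i ∈ Finset.univ) =>
      mul_neg_of_pos_of_neg (hw i) (hneg _ (hcon i))) hne
    linarith
  have hzi0 : z i0 = v := (hz ⟨i0, rfl⟩).resolve_right hi0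
  have hzS : ∀ i : {i // i ≠ i0}, ∃ k, h x k = 0 ∧ hg x k = z i := by
    intro i
    rcases hz ⟨i.1, rfl⟩ with h4 | h4
    · exact absurd (hai.injective (h4.trans hzi0.symm)) i.2
    · exact h4
  choose idx hidx1 hidx2 using hzS
  let e := Fintype.equivFin {i // i ≠ i0}
  refine ⟨_, idx ∘ e.symm, fun i => w (e.symm i) / w i0, ?_, ?_, ?_, ?_⟩
  · rw [Fintype.card_subtype_compl, Fintype.card_subtype_eq]; omega
  · intro i; exact div_nonneg (hw _).le (hw _).le
  · intro i; exact hidx1 _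
  · have h4 := e.symm.sum_comp (fun i => (w i / w i0) • hg x (idx i))
    change v + ∑ i, (w (e.symm i) / w i0) • hg x (idx (e.symm i)) = 0
    rw [h4]
    simp_rw [hidx2]
    have h5 : w i0 • v + ∑ i : {i // i ≠ i0}, w i • z i = 0 := by
      rw [← hsum, ← hzi0, Fintype.sum_eq_add_sum_subtype_ne _ i0]
    have h6 : v + ∑ i : {i // i ≠ i0}, (w i / w i0) • z i
        = (w i0)⁻¹ • (w i0 • v + ∑ i : {i // i ≠ i0}, w i • z i) := by
      rw [smul_add, smul_smul, inv_mul_cancel₀ (hw i0).ne', one_smul, Finset.smul_sum]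
      congr 1
      refine Finset.sum_congr rfl fun i _ => ?_
      rw [smul_smul, div_eq_inv_mul]
    rw [h6, h5, smul_zero]

/-- KKT conditions with a discrete multiplier supported on at most `n` points,
for a local optimum of the SISDP under Slater's constraint qualification. -/
theorem sisdp_kkt_existence {n m : ℕ} {T : Type*} [MetricSpace T] [CompactSpace T]
    (f : EuclideanSpace ℝ (Fin n) → ℝ)
    (fgrad : EuclideanSpace ℝ (Fin n) → EuclideanSpace ℝ (Fin n))
    (hf : ∀ x, HasGradientAt f (fgrad x) x) (hfgradc : Continuous fgrad)
    (g : EuclideanSpace ℝ (Fin n) → T → ℝ)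
    (hgc : Continuous fun p : EuclideanSpace ℝ (Fin n) × T => g p.1 p.2)
    (hgconv : ∀ τ : T, ConvexOn ℝ Set.univ fun x => g x τ)
    (ggrad : EuclideanSpace ℝ (Fin n) → T → EuclideanSpace ℝ (Fin n))
    (hgg : ∀ x τ, HasGradientAt (fun z => g z τ) (ggrad x τ) x)
    (hggc : Continuous fun p : EuclideanSpace ℝ (Fin n) × T => ggrad p.1 p.2)
    (F0 : Matrix (Fin m) (Fin m) ℝ) (Fmat : Fin n → Matrix (Fin m) (Fin m) ℝ)
    (hF0 : F0.IsSymm) (hFi : ∀ i, (Fmat i).IsSymm)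
    (Fx : EuclideanSpace ℝ (Fin n) → Matrix (Fin m) (Fin m) ℝ)
    (hFx : ∀ x, Fx x = F0 + ∑ i, x i • Fmat i)
    -- Slater's constraint qualification
    (hSlater : ∃ xbar, (Fx xbar).PosDef ∧ ∀ τ, g xbar τ < 0)
    (xstar : EuclideanSpace ℝ (Fin n))
    -- x* is a local optimal solution of the SISDP
    (hfeas : (∀ τ, g xstar τ ≤ 0) ∧ (Fx xstar).PosSemidef)
    (hlocal : ∀ᶠ x in 𝓝 xstar, ((∀ τ, g x τ ≤ 0) ∧ (Fx x).PosSemidef) → f xstar ≤ f x) :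
    ∃ q : ℕ, q ≤ n ∧ ∃ (τ : Fin q → T) (lam : Fin q → ℝ) (V : Matrix (Fin m) (Fin m) ℝ),
      (∀ i, 0 ≤ lam i) ∧ V.PosSemidef ∧
      (∀ j, fgrad xstar j + (∑ i, lam i * ggrad xstar (τ i) j) - (Fmat j * V).trace = 0) ∧
      jordan (Fx xstar) V = 0 ∧ (Fx xstar).PosSemidef ∧
      (∑ i, lam i * g xstar (τ i)) = 0 ∧ ∀ τ' : T, g xstar τ' ≤ 0 := by
  classical
  obtain ⟨xbar, hpd, hgb⟩ := hSlater
  let Sp := Metric.sphere (0 : Fin m → ℝ) 1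
  let h : EuclideanSpace ℝ (Fin n) → T ⊕ Sp → ℝ := fun x =>
    Sum.elim (g x) (fun u => -(u.1 ⬝ᵥ (Fx x).mulVec u.1))
  let b : Sp → EuclideanSpace ℝ (Fin n) := fun u =>
    WithLp.toLp 2 fun j => -(u.1 ⬝ᵥ (Fmat j).mulVec u.1)
  let hg : EuclideanSpace ℝ (Fin n) → T ⊕ Sp → EuclideanSpace ℝ (Fin n) := fun x =>
    Sum.elim (ggrad x) b
  have hquad : ∀ x (u : Fin m → ℝ), u ⬝ᵥ (Fx x).mulVec u =
      u ⬝ᵥ F0.mulVec u + ∑ i, x i * (u ⬝ᵥ (Fmat i).mulVec u) := by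
    intro x u
    rw [hFx, Matrix.add_mulVec, dotProduct_add, Matrix.sum_mulVec, dotProduct_sum]
    simp [Matrix.smul_mulVec, dotProduct_smul]
  have hFsymm : ∀ x, (Fx x).IsSymm := by
    intro x
    rw [hFx]
    unfold Matrix.IsSymm
    rw [Matrix.transpose_add, Matrix.transpose_sum, hF0.eq]
    simp [Matrix.transpose_smul, (hFi _).eq]
  have hc : Continuous fun p : EuclideanSpace ℝ (Fin n) × (T ⊕ Sp) => h p.1 p.2 := by
    rw [← Homeomorph.prodSumDistrib.symm.comp_continuous_iff', continuous_sum_dom]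
    refine ⟨hgc, ?_⟩
    change Continuous fun p : EuclideanSpace ℝ (Fin n) × Sp =>
      -((p.2 : Fin m → ℝ) ⬝ᵥ (Fx p.1).mulVec (p.2 : Fin m → ℝ))
    simp_rw [hquad]
    have h1 : Continuous fun p : EuclideanSpace ℝ (Fin n) × (Fin m → ℝ) =>
        -(p.2 ⬝ᵥ F0.mulVec p.2 + ∑ i, p.1 i * (p.2 ⬝ᵥ (Fmat i).mulVec p.2)) := by
      simp only [dotProduct, Matrix.mulVec]
      fun_prop
    exact h1.comp (continuous_fst.prodMk (continuous_subtype_val.comp continuous_snd))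
  have hgc' : Continuous fun p : EuclideanSpace ℝ (Fin n) × (T ⊕ Sp) => hg p.1 p.2 := by
    rw [← Homeomorph.prodSumDistrib.symm.comp_continuous_iff', continuous_sum_dom]
    refine ⟨hggc, ?_⟩
    change Continuous fun p : EuclideanSpace ℝ (Fin n) × Sp => b p.2
    have h1 : Continuous fun u : Fin m → ℝ =>
        (WithLp.toLp 2 fun j => -(u ⬝ᵥ (Fmat j).mulVec u) : EuclideanSpace ℝ (Fin n)) := by
      simp only [dotProduct, Matrix.mulVec]
      fun_prop
    exact h1.comp (continuous_subtype_val.comp continuous_snd)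
  have hineq : ∀ x y i, h x i + inner ℝ (hg x i) (y - x) ≤ h y i := by
    rintro x y (τ | u)
    · exact kkt_grad_ineq (hgconv τ) (hgg x τ) y
    · apply le_of_eq
      change -(u.1 ⬝ᵥ (Fx x).mulVec u.1) + inner ℝ (b u) (y - x) = -(u.1 ⬝ᵥ (Fx y).mulVec u.1)
      have : inner ℝ (b u) (y - x) = ∑ j, (y j - x j) * -(u.1 ⬝ᵥ (Fmat j).mulVec u.1) := by
        simp [b, PiLp.inner_apply]
      rw [this, hquad, hquad]
      simp only [sub_mul, mul_neg, Finset.sum_sub_distrib, Finset.sum_neg_distrib]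
      ring
  have hpsd_iff : ∀ x, (∀ u : Sp, 0 ≤ u.1 ⬝ᵥ (Fx x).mulVec u.1) → (Fx x).PosSemidef := by
    intro x hx
    refine Matrix.PosSemidef.of_dotProduct_mulVec_nonneg ?_ ?_
    · rw [Matrix.IsHermitian, Matrix.conjTranspose_eq_transpose_of_trivial]; exact hFsymm x
    · intro u
      by_cases hu : u = 0
      · simp [hu]
      · have hn : 0 < ‖u‖ := norm_pos_iff.2 hu
        have h1 := hx ⟨‖u‖⁻¹ • u, by simp [Sp, norm_smul, hn.ne']⟩
        simp only [Matrix.mulVec_smul, smul_dotProduct, dotProduct_smul, smul_eq_mul] at h1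
        have h2 : 0 < ‖u‖⁻¹ := inv_pos.2 hn
        rw [star_trivial]
        exact nonneg_of_mul_nonneg_right (nonneg_of_mul_nonneg_right h1 h2) h2
  obtain ⟨q, idx, lam, hq, hlam, hact, hsum⟩ := kkt_fritz h hg hc hgc' hineq xstar xbar
    (fgrad xstar) f (hf xstar).hasFDerivAt
    (by
      rintro (τ | u)
      · exact hfeas.1 τ
      · have := hfeas.2.dotProduct_mulVec_nonneg u.1
        rw [star_trivial] at this
        exact neg_nonpos.2 this)
    (by
      rintro (τ | u)
      · exact hgb τ
      · have hu : u.1 ≠ 0 := by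
          intro h0
          have := u.2
          simp [Sp, h0] at this
        have := hpd.dotProduct_mulVec_pos hu
        rw [star_trivial] at this
        exact neg_neg_iff_pos.2 this)
    (by
      filter_upwards [hlocal] with y hy hyf
      exact hy ⟨fun τ => hyf (Sum.inl τ), hpsd_iff y fun u => by
        have := hyf (Sum.inr u)
        change -(u.1 ⬝ᵥ (Fx y).mulVec u.1) ≤ 0 at this
        linarith⟩)
  rw [finrank_euclideanSpace_fin] at hq
  let P := {i : Fin q // (idx i).isLeft}
  let e : P ≃ Fin (Fintype.card P) := Fintype.equivFin P
  let W : Sp → Matrix (Fin m) (Fin m) ℝ := fun u => Matrix.vecMulVec u.1 u.1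
  let Vf : Fin q → Matrix (Fin m) (Fin m) ℝ := fun i => lam i • Sum.elim (fun _ => 0) W (idx i)
  have hker : ∀ i, Fx xstar * Vf i = 0 := by
    intro i
    have ha := hact i
    simp only [Vf]
    rcases hi : idx i with τ | u
    · simp
    · rw [hi] at ha
      have h1 : star u.1 ⬝ᵥ (Fx xstar).mulVec u.1 = 0 := by
        rw [star_trivial]; exact neg_eq_zero.1 ha
      rw [hfeas.2.dotProduct_mulVec_zero_iff] at h1
      simp [W, Matrix.mul_vecMulVec, h1]
  have hVp : ∀ i, (Vf i).PosSemidef := by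
    intro i
    refine Matrix.PosSemidef.smul ?_ (hlam i)
    rcases idx i with τ | u
    · exact Matrix.PosSemidef.zero
    · simpa using Matrix.posSemidef_vecMulVec_self_star u.1
  have hVps : (∑ i, Vf i).PosSemidef := Matrix.posSemidef_sum _ fun i _ => hVp i
  have hFV : Fx xstar * ∑ i, Vf i = 0 := by
    rw [Finset.mul_sum]; exact Finset.sum_eq_zero fun i _ => hker i
  have hVF : (∑ i, Vf i) * Fx xstar = 0 := by
    have h1 := congrArg Matrix.transpose hFV
    have h2 : (∑ i, Vf i).transpose = ∑ i, Vf i := by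
      have := hVps.isHermitian
      rwa [Matrix.IsHermitian, Matrix.conjTranspose_eq_transpose_of_trivial] at this
    rwa [Matrix.transpose_mul, h2, (hFsymm xstar).eq, Matrix.transpose_zero] at h1
  have hτ : ∀ i : P, idx i.1 = Sum.inl ((idx i.1).getLeft i.2) := by
    intro i; simp
  refine ⟨Fintype.card P, ?_, fun k => (idx (e.symm k).1).getLeft (e.symm k).2,
    fun k => lam (e.symm k).1, ∑ i, Vf i, fun k => hlam _, hVps, ?_, ?_, hfeas.2, ?_, hfeas.1⟩
  · refine le_trans ?_ hq
    simpa using Fintype.card_subtype_le (fun i : Fin q => ((idx i).isLeft : Prop))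
  · intro j
    rw [e.symm.sum_comp (fun i : P => lam i.1 * ggrad xstar ((idx i.1).getLeft i.2) j)]
    have h1 := congrArg (fun v : EuclideanSpace ℝ (Fin n) => v j) hsum
    simp only [PiLp.add_apply, PiLp.zero_apply, WithLp.ofLp_sum, Finset.sum_apply,
      PiLp.smul_apply, smul_eq_mul] at h1
    have h2 : ∀ i, lam i * hg xstar (idx i) j =
        lam i * Sum.elim (fun τ => ggrad xstar τ j) (fun _ => 0) (idx i) -
          (Fmat j * Vf i).trace := by
      intro i
      simp only [Vf]
      rcases idx i with τ | u
      · simp [hg]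
      · simp [hg, b, W, Matrix.mul_vecMulVec, Matrix.trace_vecMulVec, dotProduct_comm]
    have h3 : ∑ i : P, lam i.1 * ggrad xstar ((idx i.1).getLeft i.2) j =
        ∑ i, lam i * Sum.elim (fun τ => ggrad xstar τ j) (fun _ => 0) (idx i) := by
      have h4 : ∀ i : P, lam i.1 * ggrad xstar ((idx i.1).getLeft i.2) j =
          lam i.1 * Sum.elim (fun τ => ggrad xstar τ j) (fun _ => 0) (idx i.1) := by
        intro i; conv_rhs => rw [hτ i]
        rfl
      rw [Finset.sum_congr rfl fun i _ => h4 i]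
      rw [← Finset.sum_filter_of_ne (p := fun i => ((idx i).isLeft : Prop)), ← Finset.sum_subtype_eq_sum_filter]
      · simp [P]
      · intro i _ hne
        rcases hi : idx i with τ | u
        · simp
        · simp [hi] at hne
    rw [h3, Finset.mul_sum, Matrix.trace_sum]
    rw [Finset.sum_congr rfl fun i _ => h2 i, Finset.sum_sub_distrib] at h1
    linarith
  · simp [jordan, hFV, hVF]
  · refine Finset.sum_eq_zero fun k _ => ?_
    have := hact (e.symm k).1
    rw [hτ] at this
    change g xstar _ = 0 at this
    rw [this, mul_zero]
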